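/- Every point outside the closed quaternionic unit ball is the zero of some optimal approximant: if λ ∈ ℍ with |λ| > 1 and p₁(q) = q − λ, then p₁^{−*} ∈ H²(𝔹), ‖p₁^{−*} * p₁ − 1‖_{H²} = 0, and p₁ is the (unique) optimal approximant of degree 1 of (p₁^{−*})^{−*}. -/

import Mathlib

open MeasureTheory Filter Topology
open scoped ENNReal Classical

noncomputable section

/-! ### Basic quaternionic notions -/

instance : MeasurableSpace (Quaternion ℝ) := borel _
instance : BorelSpace (Quaternion ℝ) := ⟨rfl⟩

/-- The 2-sphere `𝕊` of quaternionic imaginary units. -/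
def USphere : Set (Quaternion ℝ) := {q | q ^ 2 = -1}

/-- The open quaternionic unit ball `𝔹`. -/
def QBall : Set (Quaternion ℝ) := {q | ‖q‖ < 1}

/-- The slice `L_I = ℝ + ℝI` through an imaginary unit `I`. -/
def sliceSet (I : Quaternion ℝ) : Set (Quaternion ℝ) :=
  {q | ∃ x y : ℝ, q = (x : Quaternion ℝ) + y • I}

/-- The point `e^{tI} = cos t + (sin t) I` of the boundary circle `∂𝔹_I`. -/
def ptOn (I : Quaternion ℝ) (t : ℝ) : Quaternion ℝ :=
  ((Real.cos t : ℝ) : Quaternion ℝ) + Real.sin t • I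

/-- Slice regularity on the unit ball: on every slice the restriction of `f` has partial
derivatives satisfying the Cauchy–Riemann equation `∂f/∂x + I ∂f/∂y = 0`. -/
def SliceRegular (f : Quaternion ℝ → Quaternion ℝ) : Prop :=
  ∀ I ∈ USphere, ∀ x y : ℝ, ((x : Quaternion ℝ) + y • I) ∈ QBall →
    ∃ fx fy : Quaternion ℝ,
      HasDerivAt (fun s : ℝ => f ((s : Quaternion ℝ) + y • I)) fx x ∧
      HasDerivAt (fun t : ℝ => f ((x : Quaternion ℝ) + t • I)) fy y ∧
      fx + I * fy = 0

/-! ### The Hardy space `H²(𝔹)` via power series coefficients.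
A slice regular function on `𝔹` is identified with its coefficient sequence
`a : ℕ → ℍ`, the function being `q ↦ ∑ qⁿ aₙ`. -/

/-- Membership in `H²(𝔹)`: square-summable coefficients. -/
def MemH2 (a : ℕ → Quaternion ℝ) : Prop := Summable (fun n => ‖a n‖ ^ 2)

/-- Evaluation of the power series `q ↦ ∑ qⁿ aₙ`. -/
def evalS (a : ℕ → Quaternion ℝ) (q : Quaternion ℝ) : Quaternion ℝ := ∑' n, q ^ n * a n

/-- The `*`-product (slice product) on coefficient sequences. -/
def sProd (a b : ℕ → Quaternion ℝ) : ℕ → Quaternion ℝ :=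
  fun n => ∑ k ∈ Finset.range (n + 1), a k * b (n - k)

/-- The regular conjugate `fᶜ`. -/
def conjS (a : ℕ → Quaternion ℝ) : ℕ → Quaternion ℝ := fun n => star (a n)

/-- The symmetrization `fˢ = f * fᶜ`. -/
def symmS (a : ℕ → Quaternion ℝ) : ℕ → Quaternion ℝ := sProd a (conjS a)

/-- The squared `H²` norm `∑ ‖aₙ‖²`. -/
def h2normSq (a : ℕ → Quaternion ℝ) : ℝ := ∑' n, ‖a n‖ ^ 2

/-- The `H²` norm. -/
def h2norm (a : ℕ → Quaternion ℝ) : ℝ := Real.sqrt (h2normSq a)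

/-- The (right) quaternionic inner product `⟨f,g⟩ = ∑ conj(bₙ) aₙ` of `H²(𝔹)`. -/
def h2inner (a b : ℕ → Quaternion ℝ) : Quaternion ℝ := ∑' n, star (b n) * a n

/-- Squared `H²`-distance of two coefficient sequences (valued in `ℝ≥0∞`). -/
def h2distSq (a b : ℕ → Quaternion ℝ) : ℝ≥0∞ := ∑' n, (‖a n - b n‖₊ : ℝ≥0∞) ^ 2

/-- The boundary value function of `f ∈ H²(𝔹)`, given by the radial limit where it exists. -/
def bdval (a : ℕ → Quaternion ℝ) (q : Quaternion ℝ) : Quaternion ℝ :=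
  if h : ∃ L, Tendsto (fun r : ℝ => evalS a ((r : Quaternion ℝ) * q)) (𝓝[<] (1 : ℝ)) (𝓝 L)
  then h.choose else 0

/-! ### The measure `Σ` on `∂𝔹` with `dΣ(e^{tI}) = dσ(I) dt`. -/

/-- The normalized area measure `σ` on the sphere `𝕊` of imaginary units
(2-dimensional Hausdorff measure, normalized so that `σ(𝕊) = 1`). -/
def sphMeasure : Measure (Quaternion ℝ) := (μH[2] USphere)⁻¹ • (μH[2]).restrict USphere

/-- The measure `Σ` on `∂𝔹`, `dΣ(e^{tI}) = dσ(I) dt`, normalized so `Σ(∂𝔹) = 1`. -/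
def SigmaBd : Measure (Quaternion ℝ) :=
  (ENNReal.ofReal (2 * Real.pi))⁻¹ •
    Measure.map (fun p : ℝ × Quaternion ℝ => ptOn p.2 p.1)
      ((volume.restrict (Set.Ico 0 (2 * Real.pi))).prod sphMeasure)

/-! ### Inner, outer, cyclic -/

/-- `f ∈ H^∞(𝔹)`: a bounded function of `H²(𝔹)`. -/
def MemHinf (a : ℕ → Quaternion ℝ) : Prop :=
  MemH2 a ∧ ∃ C : ℝ, ∀ q ∈ QBall, ‖evalS a q‖ ≤ C

/-- The `H^∞` norm: the sup of `‖f‖` on the ball. -/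
def hInfNorm (a : ℕ → Quaternion ℝ) : ℝ := sSup ((fun q => ‖evalS a q‖) '' QBall)

/-- `f` is inner: `f ∈ H^∞(𝔹)`, `‖f‖ ≤ 1` on `𝔹` and `‖f‖ = 1` `Σ`-a.e. on `∂𝔹`. -/
def IsInnerQ (a : ℕ → Quaternion ℝ) : Prop :=
  MemH2 a ∧ (∀ q ∈ QBall, ‖evalS a q‖ ≤ 1) ∧ (∀ᵐ q ∂SigmaBd, ‖bdval a q‖ = 1)

/-- `g` is outer: whenever `f ∈ H²(𝔹)` has the same boundary modulus `Σ`-a.e.,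
then `‖g‖ ≥ ‖f‖` throughout `𝔹`. -/
def IsOuterQ (g : ℕ → Quaternion ℝ) : Prop :=
  MemH2 g ∧ ∀ f, MemH2 f → (∀ᵐ q ∂SigmaBd, ‖bdval g q‖ = ‖bdval f q‖) →
    ∀ q ∈ QBall, ‖evalS f q‖ ≤ ‖evalS g q‖

/-- Quaternionic polynomials (finitely supported coefficient sequences). -/
def IsPolyQ (p : ℕ → Quaternion ℝ) : Prop := ∃ N, ∀ n > N, p n = 0

/-- Quaternionic polynomials of degree at most `n` (the space `𝒫_n`). -/
def IsPolyDeg (p : ℕ → Quaternion ℝ) (n : ℕ) : Prop := ∀ m > n, p m = 0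

/-- The coefficient sequence of the monomial `qᵏ`. -/
def qpow (k : ℕ) : ℕ → Quaternion ℝ := fun n => if n = k then 1 else 0

/-- The coefficient sequence of a constant function. -/
def constS (c : Quaternion ℝ) : ℕ → Quaternion ℝ := fun n => if n = 0 then c else 0

/-- The coefficient sequence of the constant function `1`. -/
def oneS : ℕ → Quaternion ℝ := constS 1

/-- The invariant subspace `[g]`: the `H²`-closure of `{g * p : p polynomial}`,
i.e. of the right span of `{qⁿ * g : n ≥ 0}`. -/
def InvSub (g : ℕ → Quaternion ℝ) : Set (ℕ → Quaternion ℝ) :=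
  {h | MemH2 h ∧ ∀ ε : ℝ≥0∞, 0 < ε → ∃ p, IsPolyQ p ∧ h2distSq (sProd g p) h < ε}

/-- `g` is cyclic: `[g] = H²(𝔹)`. -/
def IsCyclicQ (g : ℕ → Quaternion ℝ) : Prop :=
  MemH2 g ∧ ∀ h, MemH2 h → h ∈ InvSub g

/-! ### Bilateral (slice `L²`) series, used for boundary products -/

/-- Bilateral coefficients of `f̃(q) = f(q̄)` on `∂𝔹`: `Σ_{n ≤ 0} qⁿ a_{-n}`. -/
def tildeZ (a : ℕ → Quaternion ℝ) : ℤ → Quaternion ℝ :=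
  fun k => if k ≤ 0 then a (-k).toNat else 0

/-- Bilateral coefficients of `fᶜ` on `∂𝔹`. -/
def conjZ (a : ℕ → Quaternion ℝ) : ℤ → Quaternion ℝ :=
  fun k => if 0 ≤ k then star (a k.toNat) else 0

/-- The `*`-product of two slice `L²` functions on the boundary, on coefficients. -/
def convZ (c b : ℤ → Quaternion ℝ) : ℤ → Quaternion ℝ := fun n => ∑' k : ℤ, c k * b (n - k)

/-- Evaluation of a bilateral series `q ↦ ∑_{n ∈ ℤ} qⁿ dₙ`. -/
def evalZ (d : ℤ → Quaternion ℝ) (q : Quaternion ℝ) : Quaternion ℝ := ∑' n : ℤ, q ^ n * d n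

/-- The slice inner product `⟨qᵏ * f, f⟩_I = (1/2π)∫₀^{2π} conj(f(e^{θI})) (e^{θI})ᵏ f(e^{θI}) dθ`,
computed with boundary values; note `(qᵏ * f)(q) = qᵏ f(q)` pointwise. -/
def sliceInnerPow (a : ℕ → Quaternion ℝ) (I : Quaternion ℝ) (k : ℕ) : Quaternion ℝ :=
  (2 * Real.pi)⁻¹ •
    ∫ t in Set.Ico 0 (2 * Real.pi), star (bdval a (ptOn I t)) * ((ptOn I t) ^ k * bdval a (ptOn I t))

/-! ### Complex Hardy space `H²(𝔻)` notions (for slice restrictions) -/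

/-- Membership in the complex Hardy space `H²(𝔻)` via coefficients. -/
def CMemH2 (c : ℕ → ℂ) : Prop := Summable (fun n => ‖c n‖ ^ 2)

/-- Evaluation of a complex power series. -/
def cEval (c : ℕ → ℂ) (z : ℂ) : ℂ := ∑' n, z ^ n * c n

/-- Cauchy product of complex coefficient sequences. -/
def cConv (c d : ℕ → ℂ) : ℕ → ℂ := fun n => ∑ k ∈ Finset.range (n + 1), c k * d (n - k)

/-- Squared `H²(𝔻)` distance. -/
def cDistSq (c d : ℕ → ℂ) : ℝ≥0∞ := ∑' n, (‖c n - d n‖₊ : ℝ≥0∞) ^ 2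

/-- Radial boundary values of a complex `H²` function. -/
def cBdval (c : ℕ → ℂ) (z : ℂ) : ℂ :=
  if h : ∃ L, Tendsto (fun r : ℝ => cEval c ((r : ℂ) * z)) (𝓝[<] (1 : ℝ)) (𝓝 L)
  then h.choose else 0

/-- Lebesgue measure on the unit circle `∂𝔻` (parametrized by `θ ∈ [0, 2π)`). -/
def circleM : Measure ℂ :=
  Measure.map (fun t : ℝ => Complex.exp (t * Complex.I)) (volume.restrict (Set.Ico 0 (2 * Real.pi)))

/-- Cyclicity in `H²(𝔻)`: polynomial multiples of `c` are dense. -/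
def CIsCyclic (c : ℕ → ℂ) : Prop :=
  CMemH2 c ∧ ∀ h, CMemH2 h → ∀ ε : ℝ≥0∞, 0 < ε →
    ∃ p : ℕ → ℂ, (∃ N, ∀ n > N, p n = 0) ∧ cDistSq (cConv c p) h < ε

/-- Outerness in `H²(𝔻)` (in the sense matching Definition 2.10 of the paper). -/
def CIsOuter (c : ℕ → ℂ) : Prop :=
  CMemH2 c ∧ ∀ h, CMemH2 h →
    (∀ᵐ z ∂circleM, ‖cBdval c z‖ = ‖cBdval h z‖) →
    ∀ z ∈ Metric.ball (0 : ℂ) 1, ‖cEval h z‖ ≤ ‖cEval c z‖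

/-- Complex coordinates of a point of the slice `L_I`: if `p = x + yI` then
`sliceToC I p = x + iy`. -/
def sliceToC (I : Quaternion ℝ) (p : Quaternion ℝ) : ℂ := ⟨p.re, -(p * I).re⟩

/-- The quaternion `i`. -/
def qI : Quaternion ℝ := ⟨0, 1, 0, 0⟩

/-- The embedding of `ℂ = L_i` into the quaternions. -/
def cToQ (z : ℂ) : Quaternion ℝ := (z.re : Quaternion ℝ) + z.im • qI

/-- The imaginary unit `I_ω` identified by `ω` (any imaginary unit if `ω` is real). -/
def Iu (ω : Quaternion ℝ) : Quaternion ℝ := if ω.im = 0 then qI else ‖ω.im‖⁻¹ • ω.im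

/-! ### Optimal approximants -/

/-- `p` is an optimal approximant of degree `n` of `f^{-*}`: `p ∈ 𝒫_n` minimizes
`‖f * p - 1‖_{H²}` among all `p ∈ 𝒫_n`. -/
def IsOptApprox (a : ℕ → Quaternion ℝ) (n : ℕ) (p : ℕ → Quaternion ℝ) : Prop :=
  IsPolyDeg p n ∧ ∀ r, IsPolyDeg r n → h2distSq (sProd a p) oneS ≤ h2distSq (sProd a r) oneS

end
/-- The coefficients of `q - l`. -/
noncomputable def linS (l : Quaternion ℝ) : ℕ → Quaternion ℝ :=
  fun n => if n = 0 then -l else if n = 1 then 1 else 0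

/-- The coefficients of the `*`-inverse of `q - l`. -/
noncomputable def invS (l : Quaternion ℝ) : ℕ → Quaternion ℝ := fun n => -(l⁻¹) ^ (n + 1)

theorem sProd_lin_right (b : ℕ → Quaternion ℝ) (p : ℕ → Quaternion ℝ)
    (hp : ∀ m > 1, p m = 0) (n : ℕ) :
    sProd b p (n + 1) = b n * p 1 + b (n + 1) * p 0 := by
  unfold sProd
  rw [Finset.sum_range_succ, Finset.sum_range_succ, Finset.sum_eq_zero]
  · simp
  · intro k hk
    rw [Finset.mem_range] at hk
    rw [hp _ (by omega), mul_zero]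

theorem sProd_lin_left (b : ℕ → Quaternion ℝ) (p : ℕ → Quaternion ℝ)
    (hp : ∀ m > 1, p m = 0) (n : ℕ) :
    sProd p b (n + 1) = p 0 * b (n + 1) + p 1 * b n := by
  unfold sProd
  rw [Finset.sum_range_succ', Finset.sum_range_succ', Finset.sum_eq_zero]
  · simp [add_comm]
  · intro k hk
    rw [hp _ (by omega), zero_mul]

theorem sProd_zero (a b : ℕ → Quaternion ℝ) : sProd a b 0 = a 0 * b 0 := by
  simp [sProd]

theorem linS_deg (l : Quaternion ℝ) : ∀ m > 1, linS l m = 0 := by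
  intro m hm
  simp [linS, show m ≠ 0 by omega, show m ≠ 1 by omega]

theorem inv_lin (l : Quaternion ℝ) (h0 : l ≠ 0) : sProd (invS l) (linS l) = oneS := by
  funext n
  cases n with
  | zero => simp [sProd_zero, invS, linS, oneS, constS, h0]
  | succ n =>
    rw [sProd_lin_right _ _ (linS_deg l)]
    simp [invS, linS, oneS, constS]
    rw [pow_succ' _ (n + 1), mul_inv_rev, mul_assoc, inv_mul_cancel₀ h0]; simp

theorem lin_inv (l : Quaternion ℝ) (h0 : l ≠ 0) : sProd (linS l) (invS l) = oneS := by
  funext n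
  cases n with
  | zero => simp [sProd_zero, invS, linS, oneS, constS, h0]
  | succ n =>
    rw [sProd_lin_left _ _ (linS_deg l)]
    simp [invS, linS, oneS, constS]
    rw [pow_succ _ (n + 1), mul_inv_rev, ← mul_assoc, mul_inv_cancel₀ h0]; simp

theorem h2distSq_eq_zero {a b : ℕ → Quaternion ℝ} (h : h2distSq a b = 0) : a = b := by
  unfold h2distSq at h
  rw [ENNReal.tsum_eq_zero] at h
  funext n
  have := h n
  simpa [sub_eq_zero] using this

theorem h2distSq_self (a : ℕ → Quaternion ℝ) : h2distSq a a = 0 := by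
  simp [h2distSq]

theorem evalS_deg (a : ℕ → Quaternion ℝ) (N : ℕ) (ha : ∀ m ≥ N, a m = 0) (q : Quaternion ℝ) :
    evalS a q = ∑ n ∈ Finset.range N, q ^ n * a n := by
  unfold evalS
  apply tsum_eq_sum
  intro n hn
  rw [Finset.mem_range, not_lt] at hn
  rw [ha n hn, mul_zero]

theorem conj_lin_eval (l q : Quaternion ℝ) : evalS (conjS (linS l)) q = q - star l := by
  rw [evalS_deg _ 2]
  · simp [Finset.sum_range_succ, conjS, linS]; abel
  · intro m hm
    simp [conjS, linS_deg l m (by omega)]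

theorem symm_lin_eval (l q : Quaternion ℝ) :
    evalS (symmS (linS l)) q = l * star l - q * (l + star l) + q ^ 2 := by
  have hc : ∀ m > 1, conjS (linS l) m = 0 := by
    intro m hm
    simp [conjS, linS_deg l m hm]
  rw [evalS_deg _ 3]
  · simp only [Finset.sum_range_succ, Finset.sum_range_zero, symmS]
    rw [sProd_zero, sProd_lin_right _ _ hc 0, sProd_lin_right _ _ hc 1]
    simp [conjS, linS, mul_add]
    abel
  · intro m hm
    obtain ⟨k, rfl⟩ : ∃ k, m = k + 1 := ⟨m - 1, by omega⟩
    rw [symmS, sProd_lin_right _ _ hc, linS_deg l k (by omega), linS_deg l (k + 1) (by omega)]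
    simp

theorem inv_summable (l q : Quaternion ℝ) (hl : 1 < ‖l‖) (hq : ‖q‖ < 1) :
    Summable (fun n => q ^ n * invS l n) := by
  apply Summable.of_norm_bounded (g := fun n => ‖q‖ ^ n)
    (summable_geometric_of_lt_one (norm_nonneg _) hq)
  intro n
  simp only [invS, norm_mul, norm_neg, norm_pow, norm_inv]
  have : (‖l‖⁻¹) ^ (n + 1) ≤ 1 := pow_le_one₀ (by positivity) (inv_le_one_of_one_le₀ hl.le)
  exact mul_le_of_le_one_right (by positivity) this

theorem inv_eval_rel (l q : Quaternion ℝ) (hl : 1 < ‖l‖) (hq : ‖q‖ < 1) :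
    q * evalS (invS l) q = 1 + evalS (invS l) q * l := by
  have h0 : l ≠ 0 := by rintro rfl; simp at hl; linarith
  have hs := inv_summable l q hl hq
  unfold evalS
  rw [← hs.tsum_mul_left, ← hs.tsum_mul_right, (hs.mul_right l).tsum_eq_zero_add, ← add_assoc]
  have : (1 : Quaternion ℝ) + q ^ 0 * invS l 0 * l = 0 := by simp [invS, h0]
  rw [this, zero_add]
  congr 1
  funext n
  simp only [invS]
  rw [pow_succ (l⁻¹) (n + 1), mul_assoc _ _ l, neg_mul, mul_assoc _ _ l, inv_mul_cancel₀ h0,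
    mul_one, pow_succ' q, mul_assoc]

theorem inv_eval (l q : Quaternion ℝ) (hl : 1 < ‖l‖) (hq : ‖q‖ < 1) :
    evalS (invS l) q = (evalS (symmS (linS l)) q)⁻¹ * evalS (conjS (linS l)) q := by
  rw [conj_lin_eval, symm_lin_eval]
  have h := inv_eval_rel l q hl hq
  set S := evalS (invS l) q
  obtain ⟨x, hx⟩ : ∃ x : ℝ, l + star l = (x : Quaternion ℝ) := ⟨2 * l.re, by
    rw [Quaternion.self_add_star]; push_cast; rfl⟩
  obtain ⟨y, hy⟩ : ∃ y : ℝ, l * star l = (y : Quaternion ℝ) := ⟨_, Quaternion.self_mul_star l⟩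
  have hcx : ∀ a : Quaternion ℝ, a * (x : Quaternion ℝ) = x * a := fun a =>
    ((Quaternion.coe_commutes x a)).symm
  have hcy : ∀ a : Quaternion ℝ, a * (y : Quaternion ℝ) = y * a := fun a =>
    ((Quaternion.coe_commutes y a)).symm
  have key : (l * star l - q * (l + star l) + q ^ 2) * S = q - star l := by
    have e1 : q ^ 2 * S = q + l + S * l * l := by
      rw [pow_two, mul_assoc, h, mul_add, ← mul_assoc, h]; noncomm_ring
    have e2 : q * (l + star l) * S = l + star l + S * l * (l + star l) := by
      rw [hx, mul_assoc, ← hcx S, ← mul_assoc, h]; noncomm_ring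
    have e3 : l * star l * S = S * (l * star l) := by rw [hy, hcy]
    rw [add_mul, sub_mul, e1, e2, e3]
    noncomm_ring
  have hne : l * star l - q * (l + star l) + q ^ 2 ≠ 0 := by
    intro hz
    rw [hz, zero_mul] at key
    have : q = star l := (sub_eq_zero.mp key.symm)
    rw [this, norm_star] at hq
    linarith
  rw [← key, inv_mul_cancel_left₀ hne]

theorem inv_mem (l : Quaternion ℝ) (hl : 1 < ‖l‖) : MemH2 (invS l) := by
  unfold MemH2
  have h1 : ‖l‖⁻¹ < 1 := inv_lt_one_of_one_lt₀ hl
  have h2 : (0 : ℝ) ≤ ‖l‖⁻¹ := by positivity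
  have := (summable_geometric_of_lt_one h2 h1)
  refine Summable.of_nonneg_of_le (fun n => by positivity) (fun n => ?_) this
  simp only [invS, norm_neg, norm_pow, norm_inv]
  rw [← pow_mul]
  exact pow_le_pow_of_le_one h2 h1.le (by omega)

theorem uniq_lin (l : Quaternion ℝ) (h0 : l ≠ 0) (r : ℕ → Quaternion ℝ) (hr : IsPolyDeg r 1)
    (h : sProd (invS l) r = oneS) : r = linS l := by
  have e0 := congrFun h 0
  have e1 := congrFun h 1
  rw [sProd_zero] at e0
  rw [sProd_lin_right _ _ hr 0] at e1
  simp only [invS, oneS, constS, if_true, zero_add, pow_one, one_ne_zero, if_false] at e0 e1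
  have r0 : r 0 = -l := by
    have := congrArg (fun t => l * t) e0
    simp only [neg_mul, mul_neg, mul_inv_cancel_left₀ h0, mul_one] at this
    rw [← this, neg_neg]
  have r1 : r 1 = 1 := by
    rw [r0, show (1 + 1 : ℕ) = 2 from rfl, pow_two] at e1
    have := congrArg (fun t => l * t) e1
    simp only [neg_mul, mul_neg, neg_neg, mul_add, mul_inv_cancel_left₀ h0, mul_zero, mul_assoc,
      inv_mul_cancel₀ h0, mul_one, mul_inv_cancel₀ h0] at this
    rw [neg_add_eq_zero] at this
    exact this
  funext n
  rcases n with _ | _ | n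
  · simpa [linS] using r0
  · simpa [linS] using r1
  · rw [hr _ (by omega), linS_deg _ _ (by omega)]

/-- Every point outside the closed unit ball is the zero of some optimal approximant:
if `|λ| > 1` and `p₁(q) = q - λ`, then `p₁^{-*} ∈ H²(𝔹)`, `‖p₁^{-*} * p₁ - 1‖_{H²} = 0`,
and `p₁` is the unique optimal approximant of degree 1 of `(p₁^{-*})^{-*}`. -/
theorem point_outside_is_zero_of_opt_approx (l : Quaternion ℝ) (hl : 1 < ‖l‖) :
    ∃ b : ℕ → Quaternion ℝ,
      MemH2 b ∧
      (∀ q ∈ QBall, evalS b q = (evalS (symmS (fun n => if n = 0 then -l else if n = 1 then 1 else 0)) q)⁻¹ *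
        evalS (conjS (fun n => if n = 0 then -l else if n = 1 then 1 else 0)) q) ∧
      sProd b (fun n => if n = 0 then -l else if n = 1 then 1 else 0) = oneS ∧
      sProd (fun n => if n = 0 then -l else if n = 1 then 1 else 0) b = oneS ∧
      h2distSq (sProd b (fun n => if n = 0 then -l else if n = 1 then 1 else 0)) oneS = 0 ∧
      IsOptApprox b 1 (fun n => if n = 0 then -l else if n = 1 then 1 else 0) ∧
      (∀ r, IsOptApprox b 1 r → r = (fun n => if n = 0 then -l else if n = 1 then 1 else 0)) := by
  have h0 : l ≠ 0 := by rintro rfl; simp at hl; linarith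
  change ∃ b : ℕ → Quaternion ℝ, MemH2 b ∧
    (∀ q ∈ QBall, evalS b q = (evalS (symmS (linS l)) q)⁻¹ * evalS (conjS (linS l)) q) ∧
    sProd b (linS l) = oneS ∧ sProd (linS l) b = oneS ∧ h2distSq (sProd b (linS l)) oneS = 0 ∧
    IsOptApprox b 1 (linS l) ∧ (∀ r, IsOptApprox b 1 r → r = linS l)
  have hd : h2distSq (sProd (invS l) (linS l)) oneS = 0 := by
    rw [inv_lin l h0, h2distSq_self]
  refine ⟨invS l, inv_mem l hl, fun q hq => inv_eval l q hl hq, inv_lin l h0, lin_inv l h0, hd,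
    ⟨linS_deg l, fun r _ => by rw [hd]; exact zero_le⟩, ?_⟩
  intro r hr
  apply uniq_lin l h0 r hr.1
  apply h2distSq_eq_zero
  have := hr.2 (linS l) (linS_deg l)
  rw [hd] at this
  exact nonpos_iff_eq_zero.mp this
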